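/- Let j and n be positive integers and let w be a win condition with 1/2 ≤ w < j/(j+2). Then the w-power index process on the graph G_{j,n}, started from the initial configuration C_0 that assigns strategy C (collaborator) to every vertex of the clique K_j and strategy D (defector) to every other vertex, is collaborator dominant. -/

import Mathlib

open scoped Classical

/-- A strategy of a voter: collaborator (`C`) or defector (`D`). -/
inductive Strategy : Type
  | C : Strategy
  | D : Strategy
deriving DecidableEq

noncomputable section

variable {V : Type*}

/-- The closed neighbourhood `N[v]` of a vertex, as a finset. -/
def closedNbhd (G : SimpleGraph V) [Fintype V] (v : V) : Finset V :=
  Finset.univ.filter fun u => u = v ∨ G.Adj u v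

/-- The (Shapley–Shubik style) power of a vertex `v` in configuration `c`
with win condition `w`. -/
def power (G : SimpleGraph V) [Fintype V] (w : ℝ) (c : V → Strategy) (v : V) : ℝ :=
  let N := closedNbhd G v
  let nC := (N.filter fun u => c u = Strategy.C).card
  let nD := (N.filter fun u => c u = Strategy.D).card
  match c v with
  | Strategy.C => if w < (nC : ℝ) / (N.card : ℝ) then 1 / (nC : ℝ) else 0
  | Strategy.D => if (nC : ℝ) / (N.card : ℝ) ≤ w then 1 / (nD : ℝ) else 0

/-- One step of the `w`-power index process: every vertex adopts the strategy of a
vertex of maximum power in its closed neighbourhood, retaining its own strategy if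
vertices of maximum power have differing strategies. -/
def step (G : SimpleGraph V) [Fintype V] (w : ℝ) (c : V → Strategy) (v : V) : Strategy :=
  let N := closedNbhd G v
  let M := N.filter fun u => ∀ x ∈ N, power G w c x ≤ power G w c u
  if ∀ u ∈ M, c u = Strategy.C then Strategy.C
  else if ∀ u ∈ M, c u = Strategy.D then Strategy.D
  else c v

/-- `configSeq G w c0 i` is the configuration `C_i` of the `w`-power index process. -/
def configSeq (G : SimpleGraph V) [Fintype V] (w : ℝ) (c0 : V → Strategy) : ℕ → V → Strategy
  | 0 => c0
  | k + 1 => step G w (configSeq G w c0 k)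

/-- The process is eventually stable. -/
def EventuallyStable (G : SimpleGraph V) [Fintype V] (w : ℝ) (c0 : V → Strategy) : Prop :=
  ∃ i, configSeq G w c0 (i + 1) = configSeq G w c0 i

/-- The process reaches a stable all-collaborator configuration. -/
def CollaboratorDominant (G : SimpleGraph V) [Fintype V] (w : ℝ) (c0 : V → Strategy) : Prop :=
  ∃ i, configSeq G w c0 (i + 1) = configSeq G w c0 i ∧
    ∀ v, configSeq G w c0 i v = Strategy.C

/-- The process reaches a stable all-defector configuration. -/
def DefectorDominant (G : SimpleGraph V) [Fintype V] (w : ℝ) (c0 : V → Strategy) : Prop :=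
  ∃ i, configSeq G w c0 (i + 1) = configSeq G w c0 i ∧
    ∀ v, configSeq G w c0 i v = Strategy.D

/-- The process is eventually periodic with period `ℓ`: `ℓ > 1` is the least integer
such that `C_i = C_{i+ℓ}` for some `i ≥ 0`. -/
def EventuallyPeriodicWithPeriod (G : SimpleGraph V) [Fintype V] (w : ℝ)
    (c0 : V → Strategy) (ℓ : ℕ) : Prop :=
  IsLeast {m : ℕ | 1 < m ∧ ∃ i, configSeq G w c0 (i + m) = configSeq G w c0 i} ℓ

end

/-- `IsGjn G j n` witnesses that `G` is a graph of the form `G_{j,n}`: a disjoint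
union of cliques of sizes `j, 2j, 4j, …, j·2^n` (block `i` has size `j·2^i`), with
edges only inside blocks and between successive blocks, such that every vertex of
block `i < n` has exactly two neighbours in block `i+1` and every vertex of block
`i ≥ 1` has exactly one neighbour in block `i-1`. -/
structure IsGjn {V : Type*} [Fintype V] (G : SimpleGraph V) (j n : ℕ) : Type _ where
  blk : V → ℕ
  blk_le : ∀ v, blk v ≤ n
  card_blk : ∀ i ≤ n, (Finset.univ.filter fun v => blk v = i).card = j * 2 ^ i
  adj_within : ∀ u v : V, u ≠ v → blk u = blk v → G.Adj u v
  adj_between : ∀ u v : V, G.Adj u v →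
    blk u = blk v ∨ blk u + 1 = blk v ∨ blk v + 1 = blk u
  up_two : ∀ v : V, blk v < n →
    (Finset.univ.filter fun u => G.Adj v u ∧ blk u = blk v + 1).card = 2
  down_one : ∀ v : V, 1 ≤ blk v →
    (Finset.univ.filter fun u => G.Adj v u ∧ blk u + 1 = blk v).card = 1

theorem mem_closedNbhd' {V : Type} [Fintype V] (G : SimpleGraph V) (u v : V) :
    u ∈ closedNbhd G v ↔ u = v ∨ G.Adj u v := by
  simp [closedNbhd]

theorem step_eq_C {V : Type} [Fintype V] (G : SimpleGraph V) (w : ℝ) (c : V → Strategy) (v u : V)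
    (hu : u ∈ closedNbhd G v)
    (hx : ∀ x ∈ closedNbhd G v, c x = Strategy.D → power G w c x < power G w c u) :
    step G w c v = Strategy.C := by
  unfold step
  simp only
  rw [if_pos]
  intro y hy
  rw [Finset.mem_filter] at hy
  cases hc : c y with
  | C => rfl
  | D => exact absurd (hx y hy.1 hc) (not_lt.mpr (hy.2 u hu))

theorem step_eq_D {V : Type} [Fintype V] (G : SimpleGraph V) (w : ℝ) (c : V → Strategy) (v : V)
    (hx : ∀ x ∈ closedNbhd G v, c x = Strategy.D) :
    step G w c v = Strategy.D := by
  obtain ⟨m, hm, hmax⟩ := Finset.exists_max_image (closedNbhd G v) (power G w c)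
    ⟨v, by simp [mem_closedNbhd']⟩
  unfold step
  simp only
  rw [if_neg, if_pos]
  · intro y hy
    exact hx y (Finset.mem_filter.mp hy).1
  · intro hall
    have h1 := hall m (Finset.mem_filter.mpr ⟨hm, hmax⟩)
    rw [hx m hm] at h1
    cases h1

/-- The configuration in which blocks `0, …, k` collaborate. -/
noncomputable def blkConf {V : Type} [Fintype V] {G : SimpleGraph V} {j n : ℕ}
    (h : IsGjn G j n) (k : ℕ) : V → Strategy :=
  fun v => if h.blk v ≤ k then Strategy.C else Strategy.D

section
variable {V : Type} [Fintype V] {G : SimpleGraph V} {j n : ℕ}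

theorem blkConf_C (h : IsGjn G j n) (k : ℕ) (v : V) :
    blkConf h k v = Strategy.C ↔ h.blk v ≤ k := by
  unfold blkConf; split_ifs <;> simp_all

theorem blkConf_D (h : IsGjn G j n) (k : ℕ) (v : V) :
    blkConf h k v = Strategy.D ↔ k < h.blk v := by
  unfold blkConf; split_ifs <;> simp_all

theorem block_mem (h : IsGjn G j n) (u v : V) (huv : h.blk u = h.blk v) :
    u ∈ closedNbhd G v := by
  rw [mem_closedNbhd']
  by_cases e : u = v
  · exact Or.inl e
  · exact Or.inr (h.adj_within u v e huv)

theorem power_D_le (h : IsGjn G j n) (hj : 0 < j) (w : ℝ) (k : ℕ) (v : V) (hv : k < h.blk v) :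
    power G w (blkConf h k) v ≤ 1 / ((j * 2 ^ (k + 1) : ℕ) : ℝ) := by
  have hc := (blkConf_D h k v).2 hv
  unfold power
  simp only [hc]
  split_ifs
  · apply one_div_le_one_div_of_le
    · have : 0 < j * 2 ^ (k+1) := by positivity
      exact_mod_cast this
    · have h1 : j * 2 ^ (k+1) ≤ j * 2 ^ h.blk v :=
        Nat.mul_le_mul_left _ (Nat.pow_le_pow_right (by norm_num) hv)
      have h2 := h.card_blk (h.blk v) (h.blk_le v)
      have h3 : (Finset.univ.filter fun u => h.blk u = h.blk v) ⊆
          (closedNbhd G v).filter fun u => blkConf h k u = Strategy.D := by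
        intro u hu
        rw [Finset.mem_filter] at hu ⊢
        exact ⟨block_mem h u v hu.2, (blkConf_D h k u).2 (by omega)⟩
      have h4 := Finset.card_le_card h3
      exact_mod_cast (by omega : j * 2 ^ (k+1) ≤ _)
  · positivity

theorem power_C_ge (h : IsGjn G j n) (hj : 0 < j) (w : ℝ) (hw2 : w < (j : ℝ) / ((j : ℝ) + 2))
    (k : ℕ) (hk : k < n) (v : V) (hv : h.blk v = k) :
    1 / ((j * 2 ^ k + 1 : ℕ) : ℝ) ≤ power G w (blkConf h k) v := by
  have hc := (blkConf_C h k v).2 hv.le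
  unfold power
  simp only [hc]
  set A := (closedNbhd G v).filter fun u => blkConf h k u = Strategy.C with hA
  have hb := h.card_blk k hk.le
  have hlow : j ≤ A.card := by
    have h3 : (Finset.univ.filter fun u => h.blk u = k) ⊆ A := by
      intro u hu
      rw [Finset.mem_filter] at hu
      rw [hA, Finset.mem_filter]
      exact ⟨block_mem h u v (by omega), (blkConf_C h k u).2 (by omega)⟩
    have h4 := Finset.card_le_card h3
    have h5 : j * 1 ≤ j * 2 ^ k := Nat.mul_le_mul_left _ Nat.one_le_two_pow
    omega
  have hup : A.card ≤ j * 2 ^ k + 1 := by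
    have h3 : A ⊆ (Finset.univ.filter fun u => h.blk u = k) ∪
        (Finset.univ.filter fun u => G.Adj v u ∧ h.blk u + 1 = h.blk v) := by
      intro u hu
      rw [hA, Finset.mem_filter, mem_closedNbhd', blkConf_C] at hu
      simp only [Finset.mem_union, Finset.mem_filter, Finset.mem_univ, true_and]
      obtain ⟨h1 | h1, h2⟩ := hu
      · left; rw [h1, hv]
      · have := h.adj_between u v h1
        by_cases e : h.blk u = k
        · exact Or.inl e
        · exact Or.inr ⟨h1.symm, by omega⟩
    have h4 := (Finset.card_le_card h3).trans (Finset.card_union_le _ _)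
    have h5 : (Finset.univ.filter fun u => G.Adj v u ∧ h.blk u + 1 = h.blk v).card ≤ 1 := by
      by_cases e : 1 ≤ h.blk v
      · exact (h.down_one v e).le
      · rw [Finset.filter_false_of_mem]
        · simp
        · intro u _ hu
          omega
    omega
  have hN : (closedNbhd G v).card ≤ A.card + 2 := by
    have h3 : closedNbhd G v ⊆ A ∪
        (Finset.univ.filter fun u => G.Adj v u ∧ h.blk u = h.blk v + 1) := by
      intro u hu
      rw [Finset.mem_union, hA, Finset.mem_filter, blkConf_C]
      by_cases e : h.blk u ≤ k
      · exact Or.inl ⟨hu, e⟩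
      · right
        rw [mem_closedNbhd'] at hu
        simp only [Finset.mem_filter, Finset.mem_univ, true_and]
        rcases hu with rfl | h1
        · omega
        · have := h.adj_between u v h1
          exact ⟨h1.symm, by omega⟩
    have h4 := (Finset.card_le_card h3).trans (Finset.card_union_le _ _)
    have h5 := h.up_two v (by omega)
    omega
  have hAN : A.card ≤ (closedNbhd G v).card := Finset.card_filter_le _ _
  have hj' : (0 : ℝ) < j := by exact_mod_cast hj
  have hlow' : (j : ℝ) ≤ A.card := by exact_mod_cast hlow
  have hN' : ((closedNbhd G v).card : ℝ) ≤ A.card + 2 := by exact_mod_cast hN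
  have hAN' : (A.card : ℝ) ≤ (closedNbhd G v).card := by exact_mod_cast hAN
  rw [if_pos]
  · apply one_div_le_one_div_of_le
    · linarith
    · exact_mod_cast hup
  · refine hw2.trans_le ?_
    rw [div_le_div_iff₀ (by linarith) (by linarith)]
    nlinarith

theorem step_blkConf (h : IsGjn G j n) (hj : 2 ≤ j) (w : ℝ) (hw2 : w < (j : ℝ) / ((j : ℝ) + 2))
    (k : ℕ) (hk : k < n) : step G w (blkConf h k) = blkConf h (k + 1) := by
  have key : ∀ x u : V, k < h.blk x → h.blk u = k →
      power G w (blkConf h k) x < power G w (blkConf h k) u := by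
    intro x u hx hu
    refine (power_D_le h (by omega) w k x hx).trans_lt
      (lt_of_lt_of_le ?_ (power_C_ge h (by omega) w hw2 k hk u hu))
    apply one_div_lt_one_div_of_lt
    · exact_mod_cast Nat.succ_pos _
    · have h1 : 1 ≤ 2 ^ k := Nat.one_le_two_pow
      have h2 : j * 2 ^ k + 1 < j * 2 ^ (k + 1) := by
        rw [pow_succ]; nlinarith
      exact_mod_cast h2
  funext v
  rcases lt_trichotomy (h.blk v) k with hv | hv | hv
  · rw [(blkConf_C h (k+1) v).2 (by omega)]
    refine step_eq_C G w _ v v ((mem_closedNbhd' G v v).2 (Or.inl rfl)) ?_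
    intro x hx hD
    rw [blkConf_D] at hD
    rw [mem_closedNbhd'] at hx
    rcases hx with rfl | hx
    · omega
    · have := h.adj_between x v hx
      omega
  · rw [(blkConf_C h (k+1) v).2 (by omega)]
    refine step_eq_C G w _ v v ((mem_closedNbhd' G v v).2 (Or.inl rfl)) ?_
    intro x hx hD
    rw [blkConf_D] at hD
    exact key x v hD hv
  · by_cases e : h.blk v = k + 1
    · rw [(blkConf_C h (k+1) v).2 (by omega)]
      have h1 := h.down_one v (by omega)
      obtain ⟨u, hu⟩ := Finset.card_pos.mp (by rw [h1]; exact Nat.one_pos)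
      simp only [Finset.mem_filter, Finset.mem_univ, true_and] at hu
      refine step_eq_C G w _ v u ((mem_closedNbhd' G u v).2 (Or.inr hu.1.symm)) ?_
      intro x hx hD
      rw [blkConf_D] at hD
      exact key x u hD (by omega)
    · rw [(blkConf_D h (k+1) v).2 (by omega)]
      refine step_eq_D G w _ v ?_
      intro x hx
      rw [blkConf_D]
      rw [mem_closedNbhd'] at hx
      rcases hx with rfl | hx
      · omega
      · have := h.adj_between x v hx
        omega

end

/-- For positive integers `j, n` and any win condition
`1/2 ≤ w < j/(j+2)`, the `w`-power index process on `G_{j,n}`, started from the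
configuration assigning `C` to the vertices of `K_j` (block `0`) and `D` to all
other vertices, is collaborator dominant. -/
theorem statement0 {V : Type} [Fintype V] (G : SimpleGraph V) (j n : ℕ)
    (hj : 0 < j) (hn : 0 < n) (h : IsGjn G j n) (w : ℝ)
    (hw1 : 1 / 2 ≤ w) (hw2 : w < (j : ℝ) / ((j : ℝ) + 2)) :
    CollaboratorDominant G w
      (fun v => if h.blk v = 0 then Strategy.C else Strategy.D) := by
  have hj2 : 2 ≤ j := by
    by_contra hlt
    have h1 : j = 1 := by omega
    subst h1
    norm_num at hw2
    linarith
  have hseq : ∀ k ≤ n, configSeq G w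
      (fun v => if h.blk v = 0 then Strategy.C else Strategy.D) k = blkConf h k := by
    intro k
    induction k with
    | zero => intro _; funext v; simp [configSeq, blkConf]
    | succ k ih =>
      intro hk
      rw [configSeq, ih (by omega), step_blkConf h hj2 w hw2 k (by omega)]
  have hall : ∀ v, blkConf h n v = Strategy.C := fun v => (blkConf_C h n v).2 (h.blk_le v)
  refine ⟨n, ?_, ?_⟩
  · rw [configSeq, hseq n le_rfl]
    funext v
    rw [hall v]
    refine step_eq_C G w _ v v ((mem_closedNbhd' G v v).2 (Or.inl rfl)) ?_
    intro x _ hD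
    rw [hall x] at hD
    cases hD
  · rw [hseq n le_rfl]
    exact hall
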